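/- arXiv:2307.11713 — 2 statements merged into one kernel-verified Lean document; each statement's English description precedes it below -/
import Mathlib

section
/- Let R_ℓ < R_u, γ ∈ (0,1), N ∈ ℕ, and c = (1−γ)/(2(R_u−R_ℓ)(1−γ^N)). Let f, f̃ : ℝ → ℝ satisfy: (i) for all ν₁, ν₂, min((1−γ)/(1−γ^N)·(ν₁−ν₂), ν₁−ν₂)/(2(R_u−R_ℓ)) ≤ f(ν₁) − f(ν₂) ≤ max((1−γ)/(1−γ^N)·(ν₁−ν₂), ν₁−ν₂)/(2(R_u−R_ℓ)); (ii) sup_ν |f̃(ν) − f(ν)| ≤ B for some B ≥ 0. Let (ε_m)_m be real random variables, (α_m)_m a nonnegative random step-size sequence with sup_m α_m ≤ 2(R_u−R_ℓ) almost surely, ν₀ ∈ ℝ, and define ν_{m+1} = ν_m − α_m(f̃(ν_m) + ε_m), ν̄_{m+1} = ν̄_m − α_m(f(ν̄_m) − B + ε_m), ν̲_{m+1} = ν̲_m − α_m(f(ν̲_m) + B + ε_m), with ν̄₀ = ν̲₀ = ν₀. Then almost surely ν̲_m ≤ ν_m ≤ ν̄_m for all m ≥ 0. -/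
open MeasureTheory

/-- For `0 < γ < 1` and `N ≥ 1`, the ratio `(1 - γ) / (1 - γ ^ N)` is at most `1`. -/
lemma one_sub_div_one_sub_pow_le_one {γ : ℝ} (hγ : γ ∈ Set.Ioo (0 : ℝ) 1) {N : ℕ} (hN : 0 < N) :
    (1 - γ) / (1 - γ ^ N) ≤ 1 := by
  have h : γ ^ N ≤ γ := pow_le_of_le_one hγ.1.le hγ.2.le hN.ne'
  exact div_le_one_of_le₀ (by linarith) (by linarith [hγ.2])

/-- If the increments of `f` are at most `1 / L` times those of the identity, then a descent step
with step size `a ∈ [0, L]` is order preserving. -/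
lemma monotone_sub_mul_of_sub_le_div {f : ℝ → ℝ} {L a : ℝ} (hL : 0 < L)
    (hf : ∀ ⦃s t : ℝ⦄, s ≤ t → f t - f s ≤ (t - s) / L) (ha0 : 0 ≤ a) (haL : a ≤ L) :
    Monotone fun s => s - a * f s := by
  intro s t hst
  have h : a * (f t - f s) ≤ t - s := calc
    a * (f t - f s) ≤ a * ((t - s) / L) := mul_le_mul_of_nonneg_left (hf hst) ha0
    _ ≤ L * ((t - s) / L) :=
      mul_le_mul_of_nonneg_right haL (div_nonneg (sub_nonneg.2 hst) hL.le)
    _ = t - s := mul_div_cancel₀ _ hL.ne'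
  dsimp only
  linarith

/-- coupled stochastic approximation sequences sandwich the iterates.
With the two-sided slope condition on `f`, `sup_ν |f̃ ν − f ν| ≤ B`, common noise `ε`
and common nonnegative step sizes `α` bounded by `2(R_u − R_ℓ)` a.s., the three
recursions `ν`, `ν̄`, `ν̲` started at the same point satisfy `ν̲_m ≤ ν_m ≤ ν̄_m`
for all `m`, almost surely. -/
theorem coupled_sequences_sandwich
    {Ω : Type*} {m0 : MeasurableSpace Ω} (μ : Measure Ω) [IsProbabilityMeasure μ]
    (Rl Ru γ : ℝ) (N : ℕ) (hRlu : Rl < Ru) (hγ : γ ∈ Set.Ioo (0 : ℝ) 1) (hN : 0 < N)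
    (f ftilde : ℝ → ℝ)
    (hslope : ∀ ν₁ ν₂ : ℝ,
      min ((1 - γ) / (1 - γ ^ N) * (ν₁ - ν₂)) (ν₁ - ν₂) / (2 * (Ru - Rl)) ≤ f ν₁ - f ν₂ ∧
      f ν₁ - f ν₂ ≤ max ((1 - γ) / (1 - γ ^ N) * (ν₁ - ν₂)) (ν₁ - ν₂) / (2 * (Ru - Rl)))
    (B : ℝ) (hB : 0 ≤ B) (hdiff : ∀ ν : ℝ, |ftilde ν - f ν| ≤ B)
    (ε α : ℕ → Ω → ℝ)
    (hα0 : ∀ᵐ ω ∂μ, ∀ m, 0 ≤ α m ω)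
    (hαbd : ∀ᵐ ω ∂μ, ∀ m, α m ω ≤ 2 * (Ru - Rl))
    (ν₀ : ℝ) (x xbar xlow : ℕ → Ω → ℝ)
    (hx0 : ∀ ω, x 0 ω = ν₀) (hxbar0 : ∀ ω, xbar 0 ω = ν₀) (hxlow0 : ∀ ω, xlow 0 ω = ν₀)
    (hx : ∀ m ω, x (m + 1) ω = x m ω - α m ω * (ftilde (x m ω) + ε m ω))
    (hxbar : ∀ m ω, xbar (m + 1) ω = xbar m ω - α m ω * (f (xbar m ω) - B + ε m ω))
    (hxlow : ∀ m ω, xlow (m + 1) ω = xlow m ω - α m ω * (f (xlow m ω) + B + ε m ω)) :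
    ∀ᵐ ω ∂μ, ∀ m, xlow m ω ≤ x m ω ∧ x m ω ≤ xbar m ω := by
  have hL : 0 < 2 * (Ru - Rl) := by linarith
  have hf : ∀ ⦃s t : ℝ⦄, s ≤ t → f t - f s ≤ (t - s) / (2 * (Ru - Rl)) := by
    intro s t hst
    refine (hslope t s).2.trans (div_le_div_of_nonneg_right (max_le ?_ le_rfl) hL.le)
    exact mul_le_of_le_one_left (sub_nonneg.2 hst) (one_sub_div_one_sub_pow_le_one hγ hN)
  filter_upwards [hα0, hαbd] with ω h0 hbd m
  induction m with
  | zero => simp [hx0, hxbar0, hxlow0]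
  | succ m ih =>
    have hmono := monotone_sub_mul_of_sub_le_div hL hf (h0 m) (hbd m)
    have hlow := hmono ih.1
    have hup := hmono ih.2
    obtain ⟨hd₁, hd₂⟩ := abs_le.1 (hdiff (x m ω))
    have hle := mul_le_mul_of_nonneg_left hd₁ (h0 m)
    have hge := mul_le_mul_of_nonneg_left hd₂ (h0 m)
    dsimp only at hlow hup
    rw [hx, hxbar, hxlow]
    constructor <;> linarith
end

section
/- Let R_ℓ < R_u and let f̃ : ℝ → ℝ be a bounded Lipschitz continuous function with f̃(ν) < 0 for all ν < R_ℓ and f̃(ν) > 0 for all ν > R_u. Let (ε_m)_{m≥1} be a bounded martingale difference sequence, let (α_m)_m be a nonnegative predictable step-size sequence satisfying almost surely Σ_m α_m = ∞ and Σ_m α_m² < ∞, let ν₀ ∈ [R_ℓ, R_u], and define ν_{m+1} = ν_m − α_m·(f̃(ν_m) + ε_m). Then (ν_m)_m converges almost surely to a random variable ν̃ ∈ [R_ℓ, R_u] satisfying f̃(ν̃) = 0. -/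
open MeasureTheory Filter

/-- The "past" σ-algebras of the natural filtration of a process `ε`:
`F₀ = ⊥` (trivial) and `F_{m+1} = σ(ε_0, …, ε_m)`. -/
noncomputable def pastFiltration {Ω : Type*} {m0 : MeasurableSpace Ω}
    (ε : ℕ → Ω → ℝ) (hε : ∀ i, StronglyMeasurable (ε i)) : ℕ → MeasurableSpace Ω
  | 0 => ⊥
  | (k + 1) => MeasureTheory.Filtration.natural ε hε k

/-- `y` is an Euler scheme with step sizes `a` for `dy/dt = -f y`, the drift being evaluated along a
sequence `x` asymptotic to `y`. -/
structure IsPerturbedEuler (f : ℝ → ℝ) (a x y : ℕ → ℝ) : Prop where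
  step_nonneg : ∀ n, 0 ≤ a n
  rec_eq : ∀ n, y (n + 1) = y n - a n * f (x n)
  sub_tendsto : Tendsto (fun n => y n - x n) atTop (nhds 0)
  incr_tendsto : Tendsto (fun n => y (n + 1) - y n) atTop (nhds 0)

namespace IsPerturbedEuler

variable {f : ℝ → ℝ} {a x y : ℕ → ℝ}

lemma neg (h : IsPerturbedEuler f a x y) :
    IsPerturbedEuler (fun z => -f (-z)) a (fun n => -x n) (fun n => -y n) where
  step_nonneg := h.step_nonneg
  rec_eq n := by simp only [h.rec_eq n, neg_neg]; ring
  sub_tendsto := by simpa [add_comm, sub_eq_add_neg] using h.sub_tendsto.neg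
  incr_tendsto := by simpa [add_comm, sub_eq_add_neg] using h.incr_tendsto.neg

lemma exists_forall_abs_lt (h : IsPerturbedEuler f a x y) {η : ℝ} (hη : 0 < η) :
    ∃ N, ∀ n ≥ N, |y n - x n| < η ∧ |y (n + 1) - y n| < η := by
  have h1 := h.sub_tendsto.abs.eventually_lt_const (by simpa using hη)
  have h2 := h.incr_tendsto.abs.eventually_lt_const (by simpa using hη)
  exact eventually_atTop.1 (h1.and h2)

/-- A level at which the drift points downwards is eventually not crossed upwards. -/
lemma eventually_le_or_eventually_lt (h : IsPerturbedEuler f a x y) (hf : Continuous f) {p : ℝ}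
    (hp : 0 < f p) : (∀ᶠ n in atTop, y n ≤ p) ∨ (∀ᶠ n in atTop, p < y n) := by
  obtain ⟨r, hr, hball⟩ := Metric.eventually_nhds_iff.1 (hf.continuousAt.eventually_const_lt hp)
  obtain ⟨N, hN⟩ := h.exists_forall_abs_lt (half_pos hr)
  by_cases hex : ∃ m ≥ N, y m ≤ p
  · obtain ⟨m, hm, hym⟩ := hex
    refine Or.inl (eventually_atTop.2 ⟨m, fun n hn => ?_⟩)
    induction n, hn using Nat.le_induction with
    | base => exact hym
    | succ n hn ih =>
      obtain ⟨h1, h2⟩ := hN n (hm.trans hn)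
      rw [abs_lt] at h1 h2
      rcases le_or_gt (y n) (p - r / 2) with hlow | hhigh
      · linarith
      · have hpos : 0 < f (x n) := hball (by rw [Real.dist_eq, abs_lt]; constructor <;> linarith)
        rw [h.rec_eq n]
        linarith [mul_nonneg (h.step_nonneg n) hpos.le]
  · push Not at hex
    exact Or.inr (eventually_atTop.2 ⟨N, hex⟩)

/-- A level at which the drift points upwards is eventually not crossed downwards. -/
lemma eventually_ge_or_eventually_gt (h : IsPerturbedEuler f a x y) (hf : Continuous f) {p : ℝ}
    (hp : f p < 0) : (∀ᶠ n in atTop, p ≤ y n) ∨ (∀ᶠ n in atTop, y n < p) := by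
  simpa using h.neg.eventually_le_or_eventually_lt (p := -p) (by fun_prop) (by simpa using hp)

/-- If the drift vanishes on an interval, the scheme does not keep crossing that interval. -/
lemma not_frequently_of_forall_eq_zero (h : IsPerturbedEuler f a x y) {l u : ℝ} (hlu : l < u)
    (hf : ∀ z ∈ Set.Ioo l u, f z = 0) :
    ¬((∃ᶠ n in atTop, y n < l) ∧ ∃ᶠ n in atTop, u < y n) := by
  rintro ⟨hl, hu⟩
  obtain ⟨N, hN⟩ := h.exists_forall_abs_lt (η := (u - l) / 3) (by linarith)
  obtain ⟨m, hm, hym⟩ := frequently_atTop.1 hl N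
  obtain ⟨m', hm', hym'⟩ := frequently_atTop.1 hu m
  suffices H : ∀ n ≥ m, y n < u - (u - l) / 3 by linarith [H m' hm']
  intro n hn
  by_contra! hcon
  have hfreeze : ∀ k ≥ m, l + (u - l) / 3 ≤ y k → y k ≤ u - (u - l) / 3 →
      ∀ j ≥ k, y j = y k := by
    intro k hk hk1 hk2 j hj
    induction j, hj using Nat.le_induction with
    | base => rfl
    | succ j hj ih =>
      have h1 := (hN j (by omega)).1
      rw [abs_lt, ih] at h1
      rw [h.rec_eq, hf (x j) ⟨by linarith, by linarith⟩, ih]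
      ring
  have hbelow : ∀ j ≥ m, y j < l + (u - l) / 3 := by
    intro j hj
    induction j, hj using Nat.le_induction with
    | base => linarith
    | succ j hj ih =>
      by_contra! hcon'
      have h2 := (hN j (by omega)).2
      rw [abs_lt] at h2
      obtain ⟨i, hi, hyi⟩ := frequently_atTop.1 hl (j + 1)
      linarith [hfreeze (j + 1) (by omega) hcon' (by linarith) i hi]
  linarith [hbelow n hn]

/-- Along a bounded below scheme with divergent step sizes, the drift cannot stay bounded away
from zero from above. -/
lemma not_eventually_const_le (h : IsPerturbedEuler f a x y) (ha : ¬ Summable a) {b c : ℝ}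
    (hc : 0 < c) (hb : ∀ᶠ n in atTop, b ≤ y n) : ¬ ∀ᶠ n in atTop, c ≤ f (x n) := by
  intro hcf
  obtain ⟨N, hN⟩ := eventually_atTop.1 (hb.and hcf)
  refine ha ((summable_nat_add_iff N).1 ?_)
  refine summable_of_sum_range_le (c := (y N - b) / c) (fun n => h.step_nonneg _) fun n => ?_
  have key : c * ∑ i ∈ Finset.range n, a (i + N) ≤ y N - y (n + N) := by
    induction n with
    | zero => simp
    | succ n ih =>
      have h1 := mul_le_mul_of_nonneg_left (hN (n + N) (by omega)).2 (h.step_nonneg (n + N))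
      rw [Finset.sum_range_succ, show n + 1 + N = n + N + 1 by omega, h.rec_eq]
      linarith
  rw [le_div_iff₀ hc]
  linarith [(hN (n + N) (by omega)).1]

lemma tendsto_of_tendsto (h : IsPerturbedEuler f a x y) {q : ℝ} (hq : Tendsto y atTop (nhds q)) :
    Tendsto x atTop (nhds q) := by
  simpa using hq.sub h.sub_tendsto

lemma limit_nonpos (h : IsPerturbedEuler f a x y) (ha : ¬ Summable a) (hf : Continuous f) {q : ℝ}
    (hq : Tendsto y atTop (nhds q)) : f q ≤ 0 := by
  by_contra! hpos
  have hfx := (hf.tendsto q).comp (h.tendsto_of_tendsto hq)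
  exact h.not_eventually_const_le ha (half_pos hpos)
    (hq.eventually_const_le (sub_one_lt q)) (hfx.eventually_const_le (half_lt_self hpos))

lemma limit_isRoot (h : IsPerturbedEuler f a x y) (ha : ¬ Summable a) (hf : Continuous f) {q : ℝ}
    (hq : Tendsto y atTop (nhds q)) : f q = 0 :=
  le_antisymm (h.limit_nonpos ha hf hq)
    (by simpa using h.neg.limit_nonpos ha (by fun_prop) hq.neg)

/-- If the drift is positive above `u`, the scheme eventually stays below any level above `u`. -/
lemma eventually_le_of_forall_pos (h : IsPerturbedEuler f a x y) (ha : ¬ Summable a)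
    (hf : Continuous f) {u : ℝ} (hpos : ∀ z, u < z → 0 < f z) {p : ℝ} (hp : u < p) :
    ∀ᶠ n in atTop, y n ≤ p := by
  refine (h.eventually_le_or_eventually_lt hf (hpos p hp)).resolve_right fun hlt => ?_
  obtain ⟨N, hN⟩ := h.exists_forall_abs_lt (sub_pos.2 hp)
  obtain ⟨M, hM⟩ := eventually_atTop.1 hlt
  set K := max N M
  have hanti : Antitone fun n => y (n + K) := antitone_nat_of_succ_le fun n => by
    have h1 := (hN (n + K) (by omega)).1
    have h2 := hM (n + K) (by omega)
    rw [abs_lt] at h1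
    have h3 := hpos (x (n + K)) (by linarith)
    rw [show n + 1 + K = n + K + 1 by omega, h.rec_eq]
    linarith [mul_nonneg (h.step_nonneg (n + K)) h3.le]
  have hbdd : BddBelow (Set.range fun n => y (n + K)) :=
    ⟨p, by rintro _ ⟨n, rfl⟩; exact (hM (n + K) (by omega)).le⟩
  have hlim := (tendsto_add_atTop_iff_nat K).1 (tendsto_atTop_ciInf hanti hbdd)
  have hge := ge_of_tendsto hlim (hlt.mono fun _ => le_of_lt)
  exact (hpos _ (hp.trans_le hge)).ne' (h.limit_isRoot ha hf hlim)

lemma eventually_ge_of_forall_neg (h : IsPerturbedEuler f a x y) (ha : ¬ Summable a)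
    (hf : Continuous f) {l : ℝ} (hneg : ∀ z, z < l → f z < 0) {p : ℝ} (hp : p < l) :
    ∀ᶠ n in atTop, p ≤ y n := by
  have := h.neg.eventually_le_of_forall_pos ha (by fun_prop) (u := -l) (p := -p)
    (fun z hz => by simpa using hneg (-z) (by linarith)) (by linarith)
  simpa using this

/-- A perturbed Euler scheme with divergent step sizes converges to a root of the drift, provided
the drift points inwards outside a bounded interval. -/
theorem exists_tendsto_isRoot (h : IsPerturbedEuler f a x y) (ha : ¬ Summable a)
    (hf : Continuous f) {l u : ℝ} (hneg : ∀ z, z < l → f z < 0) (hpos : ∀ z, u < z → 0 < f z) :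
    ∃ q, Tendsto x atTop (nhds q) ∧ q ∈ Set.Icc l u ∧ f q = 0 := by
  have hnc : ∀ b c, b < c → ¬((∃ᶠ n in atTop, y n < b) ∧ ∃ᶠ n in atTop, c < y n) := by
    intro b c hbc
    by_cases hz : ∀ z ∈ Set.Ioo b c, f z = 0
    · exact h.not_frequently_of_forall_eq_zero hbc hz
    push Not at hz
    obtain ⟨p, ⟨hbp, hpc⟩, hp⟩ := hz
    rintro ⟨hb, hc⟩
    rcases hp.lt_or_gt with hp | hp
    · rcases h.eventually_ge_or_eventually_gt hf hp with hev | hev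
      · exact hb (hev.mono fun n hn => by linarith)
      · exact hc (hev.mono fun n hn => by linarith)
    · rcases h.eventually_le_or_eventually_lt hf hp with hev | hev
      · exact hc (hev.mono fun n hn => by linarith)
      · exact hb (hev.mono fun n hn => by linarith)
  obtain ⟨q, hq⟩ := tendsto_of_no_upcrossings dense_univ (fun b _ c _ => hnc b c)
    (isBoundedUnder_of_eventually_le
      (h.eventually_le_of_forall_pos ha hf hpos (lt_add_one u)))
    (isBoundedUnder_of_eventually_ge
      (h.eventually_ge_of_forall_neg ha hf hneg (sub_one_lt l)))
  have hroot := h.limit_isRoot ha hf hq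
  exact ⟨q, h.tendsto_of_tendsto hq,
    ⟨not_lt.1 fun hlt => (hneg q hlt).ne hroot, not_lt.1 fun hlt => (hpos q hlt).ne' hroot⟩, hroot⟩

end IsPerturbedEuler

/-- Deterministic convergence of a stochastic approximation recursion whose accumulated noise
converges. -/
theorem exists_tendsto_isRoot_of_noise_tendsto {f : ℝ → ℝ} {a e x : ℕ → ℝ} {C s l u : ℝ}
    (hf : Continuous f) (hC : ∀ z, |f z| ≤ C) (hneg : ∀ z, z < l → f z < 0)
    (hpos : ∀ z, u < z → 0 < f z) (ha0 : ∀ n, 0 ≤ a n) (ha : ¬ Summable a)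
    (ha2 : Summable fun n => a n ^ 2)
    (hs : Tendsto (fun n => ∑ k ∈ Finset.range n, a k * e k) atTop (nhds s))
    (hx : ∀ n, x (n + 1) = x n - a n * (f (x n) + e n)) :
    ∃ q, Tendsto x atTop (nhds q) ∧ q ∈ Set.Icc l u ∧ f q = 0 := by
  have ha_lim : Tendsto a atTop (nhds 0) := by
    have := ha2.tendsto_atTop_zero.sqrt
    simpa [Real.sqrt_sq (ha0 _)] using this
  have hrec : ∀ n, x (n + 1) + (∑ k ∈ Finset.range (n + 1), a k * e k - s) =
      x n + (∑ k ∈ Finset.range n, a k * e k - s) - a n * f (x n) := fun n => by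
    rw [hx, Finset.sum_range_succ]; ring
  have h : IsPerturbedEuler f a x fun n => x n + (∑ k ∈ Finset.range n, a k * e k - s) :=
    { step_nonneg := ha0
      rec_eq := hrec
      sub_tendsto := by simpa using hs.sub_const s
      incr_tendsto := by
        refine squeeze_zero_norm (a := fun n => a n * C) (fun n => ?_)
          (by simpa using ha_lim.mul_const C)
        rw [hrec, sub_sub_cancel_left, norm_neg, norm_mul, Real.norm_of_nonneg (ha0 n)]
        exact mul_le_mul_of_nonneg_left (hC _) (ha0 n) }
  exact h.exists_tendsto_isRoot ha hf hneg hpos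

/-- Martingale transforms of bounded martingale differences by bounded predictable weights of
uniformly bounded square sum converge almost surely. -/
theorem ae_exists_tendsto_sum_mul_of_sum_sq_le {Ω : Type*} {m0 : MeasurableSpace Ω}
    {μ : Measure Ω} [IsProbabilityMeasure μ] {ℱ : Filtration ℕ m0} {β ε : ℕ → Ω → ℝ} {B C R : ℝ}
    (hβ : ∀ n, StronglyMeasurable[ℱ n] (β n)) (hε : ∀ n, StronglyMeasurable[ℱ (n + 1)] (ε n))
    (hβB : ∀ n ω, |β n ω| ≤ B) (hεC : ∀ n ω, |ε n ω| ≤ C)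
    (hmds : ∀ n, μ[ε n | ℱ n] =ᵐ[μ] 0)
    (hR : ∀ n ω, ∑ k ∈ Finset.range n, β k ω ^ 2 ≤ R) :
    ∀ᵐ ω ∂μ, ∃ c, Tendsto (fun n => ∑ k ∈ Finset.range n, β k ω * ε k ω) atTop (nhds c) := by
  set M : ℕ → Ω → ℝ := fun n ω => ∑ k ∈ Finset.range n, β k ω * ε k ω with hM
  have hMsucc : ∀ n ω, M (n + 1) ω = M n ω + β n ω * ε n ω := fun n ω => by
    simp only [hM, Finset.sum_range_succ]
  have hMmeas : ∀ n, StronglyMeasurable[ℱ n] (M n) := fun n => by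
    refine Finset.stronglyMeasurable_fun_sum _ fun k hk => ?_
    have hk := Finset.mem_range.1 hk
    exact ((hβ k).mono (ℱ.mono hk.le)).mul ((hε k).mono (ℱ.mono hk))
  have hprod : ∀ n ω, |β n ω * ε n ω| ≤ B * C := fun n ω => by
    rw [abs_mul]
    exact mul_le_mul (hβB n ω) (hεC n ω) (abs_nonneg _) ((abs_nonneg _).trans (hβB n ω))
  have hMbdd : ∀ n ω, |M n ω| ≤ n * (B * C) := fun n ω => by
    refine (Finset.abs_sum_le_sum_abs _ _).trans ?_
    simpa using Finset.sum_le_sum fun k (_ : k ∈ Finset.range n) => hprod k ω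
  have hint : ∀ {g : Ω → ℝ} (D : ℝ), StronglyMeasurable g → (∀ ω, |g ω| ≤ D) → Integrable g μ :=
    fun D hg hD => .of_bound hg.aestronglyMeasurable D (.of_forall hD)
  have hMm0 : ∀ n, StronglyMeasurable (M n) := fun n => (hMmeas n).mono (ℱ.le n)
  have hβm0 : ∀ n, StronglyMeasurable (β n) := fun n => (hβ n).mono (ℱ.le n)
  have hεm0 : ∀ n, StronglyMeasurable (ε n) := fun n => (hε n).mono (ℱ.le _)
  have hMint : ∀ n, Integrable (M n) μ := fun n => hint _ (hMm0 n) (hMbdd n)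
  have hεint : ∀ n, Integrable (ε n) μ := fun n => hint _ (hεm0 n) (hεC n)
  have hpull : ∀ n {g : Ω → ℝ} (D : ℝ), StronglyMeasurable[ℱ n] g → (∀ ω, |g ω| ≤ D) →
      μ[g * ε n | ℱ n] =ᵐ[μ] 0 := fun n g D hg hD => by
    filter_upwards [condExp_stronglyMeasurable_mul_of_bound (ℱ.le n) hg (hεint n) D (.of_forall hD),
      hmds n] with ω h1 h2
    simp [h1, h2]
  have hmart : Martingale M ℱ μ := by
    refine martingale_of_condExp_sub_eq_zero_nat hMmeas hMint fun n => ?_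
    have : M (n + 1) - M n = β n * ε n := by
      ext ω; simp [hMsucc]
    rw [this]
    exact hpull n B (hβ n) (hβB n)
  have hM2int : ∀ n, Integrable (fun ω => M n ω ^ 2) μ := fun n =>
    hint ((n * (B * C)) ^ 2) ((hMm0 n).pow 2) fun ω => by
      rw [abs_pow]; exact pow_le_pow_left₀ (abs_nonneg _) (hMbdd n ω) 2
  have hβ2int : ∀ n, Integrable (fun ω => β n ω ^ 2) μ := fun n =>
    hint (B ^ 2) ((hβm0 n).pow 2) fun ω => by
      rw [abs_pow]; exact pow_le_pow_left₀ (abs_nonneg _) (hβB n ω) 2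
  have hsq : ∀ n, ∫ ω, M n ω ^ 2 ∂μ ≤ C ^ 2 * ∫ ω, ∑ k ∈ Finset.range n, β k ω ^ 2 ∂μ := by
    intro n
    induction n with
    | zero => simp [hM]
    | succ n ih =>
      have hbdd : ∀ ω, |(M n * β n) ω| ≤ n * (B * C) * B := fun ω => by
        rw [Pi.mul_apply, abs_mul]
        exact mul_le_mul (hMbdd n ω) (hβB n ω) (abs_nonneg _) ((abs_nonneg _).trans (hMbdd n ω))
      have hcross : ∫ ω, (M n * β n * ε n) ω ∂μ = 0 := by
        rw [← integral_condExp (ℱ.le n),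
          integral_congr_ae (hpull n _ ((hMmeas n).mul (hβ n)) hbdd)]
        simp
      have hcross_int : Integrable (M n * β n * ε n) μ :=
        (hεint n).bdd_mul ((hMm0 n).mul (hβm0 n)).aestronglyMeasurable (.of_forall hbdd)
      have hsum_int : Integrable (fun ω => ∑ k ∈ Finset.range n, β k ω ^ 2) μ :=
        integrable_finsetSum _ fun k _ => hβ2int k
      calc ∫ ω, M (n + 1) ω ^ 2 ∂μ
          ≤ ∫ ω, (M n ω ^ 2 + 2 * (M n * β n * ε n) ω + C ^ 2 * β n ω ^ 2) ∂μ := by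
            refine integral_mono (hM2int _)
              (((hM2int n).add (hcross_int.const_mul 2)).add ((hβ2int n).const_mul _)) fun ω => ?_
            have h1 : ε n ω ^ 2 ≤ C ^ 2 := by
              rw [← sq_abs]; exact pow_le_pow_left₀ (abs_nonneg _) (hεC n ω) 2
            have h2 := mul_le_mul_of_nonneg_right h1 (sq_nonneg (β n ω))
            simp only [hMsucc, Pi.mul_apply]
            linarith
        _ = ∫ ω, M n ω ^ 2 ∂μ + C ^ 2 * ∫ ω, β n ω ^ 2 ∂μ := by
            have hfirst : Integrable (fun ω => M n ω ^ 2 + 2 * (M n * β n * ε n) ω) μ :=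
              (hM2int n).add (hcross_int.const_mul 2)
            rw [integral_add hfirst ((hβ2int n).const_mul _),
              integral_add (hM2int n) (hcross_int.const_mul 2), integral_const_mul,
              integral_const_mul, hcross]
            ring
        _ ≤ C ^ 2 * ∫ ω, ∑ k ∈ Finset.range (n + 1), β k ω ^ 2 ∂μ := by
            simp only [Finset.sum_range_succ]
            rw [integral_add hsum_int (hβ2int n)]
            linarith
  have hL1 : ∀ n, eLpNorm (M n) 1 μ ≤ (Real.toNNReal (1 + C ^ 2 * R) : ENNReal) := fun n => by
    rw [eLpNorm_one_eq_lintegral_enorm, ← ofReal_integral_norm_eq_lintegral_enorm (hMint n)]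
    refine ENNReal.ofReal_le_ofReal ?_
    have h1 : ∫ ω, ‖M n ω‖ ∂μ ≤ ∫ ω, (1 + M n ω ^ 2) ∂μ := by
      refine integral_mono (hMint n).norm ((integrable_const 1).add (hM2int n)) fun ω => ?_
      simp only [Real.norm_eq_abs]
      nlinarith [sq_abs (M n ω), sq_nonneg (|M n ω| - 1)]
    have h2 : ∫ ω, ∑ k ∈ Finset.range n, β k ω ^ 2 ∂μ ≤ R := by
      have := integral_mono (integrable_finsetSum (Finset.range n) fun k _ => hβ2int k)
        (integrable_const R) (hR n)
      simpa using this
    rw [integral_add (integrable_const 1) (hM2int n)] at h1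
    simp only [integral_const, probReal_univ, smul_eq_mul, mul_one] at h1
    linarith [hsq n, mul_le_mul_of_nonneg_left h2 (sq_nonneg C)]
  exact hmart.submartingale.exists_ae_tendsto_of_bdd hL1

/-- Martingale transforms of bounded martingale differences by predictable weights which are almost
surely square summable converge almost surely. -/
theorem ae_exists_tendsto_sum_mul_of_summable_sq {Ω : Type*} {m0 : MeasurableSpace Ω}
    {μ : Measure Ω} [IsProbabilityMeasure μ] {ℱ : Filtration ℕ m0} {α ε : ℕ → Ω → ℝ} {C : ℝ}
    (hα : ∀ n, StronglyMeasurable[ℱ n] (α n)) (hε : ∀ n, StronglyMeasurable[ℱ (n + 1)] (ε n))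
    (hεC : ∀ n ω, |ε n ω| ≤ C) (hmds : ∀ n, μ[ε n | ℱ n] =ᵐ[μ] 0)
    (hsum : ∀ᵐ ω ∂μ, Summable fun n => α n ω ^ 2) :
    ∀ᵐ ω ∂μ, ∃ c, Tendsto (fun n => ∑ k ∈ Finset.range n, α k ω * ε k ω) atTop (nhds c) := by
  let A : ℕ → ℕ → Set Ω := fun N n => {ω | ∑ k ∈ Finset.range (n + 1), α k ω ^ 2 ≤ N}
  let β : ℕ → ℕ → Ω → ℝ := fun N n => (A N n).indicator (α n)
  have hA : ∀ N n, MeasurableSet[ℱ n] (A N n) := fun N n => by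
    have hS : StronglyMeasurable[ℱ n] fun ω => ∑ k ∈ Finset.range (n + 1), α k ω ^ 2 :=
      Finset.stronglyMeasurable_fun_sum _ fun k hk =>
        ((hα k).mono (ℱ.mono (Nat.lt_succ_iff.1 (Finset.mem_range.1 hk)))).pow 2
    exact hS.measurable measurableSet_Iic
  have hβR : ∀ (N n : ℕ) ω, ∑ k ∈ Finset.range n, β N k ω ^ 2 ≤ N := fun N n ω => by
    induction n with
    | zero => simp
    | succ n ih =>
      by_cases hω : ω ∈ A N n
      · refine (Finset.sum_le_sum fun k _ => ?_).trans hω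
        by_cases hk : ω ∈ A N k
        · simp [β, hk]
        · simpa [β, hk] using sq_nonneg (α k ω)
      · rw [Finset.sum_range_succ]
        simpa [β, hω] using ih
  have hβB : ∀ (N n : ℕ) ω, |β N n ω| ≤ √N := fun N n ω => by
    refine Real.abs_le_sqrt (le_trans ?_ (hβR N (n + 1) ω))
    exact Finset.single_le_sum (f := fun k => β N k ω ^ 2) (fun k _ => sq_nonneg _)
      (Finset.self_mem_range_succ n)
  have hconv : ∀ᵐ ω ∂μ, ∀ N, ∃ c,
      Tendsto (fun n => ∑ k ∈ Finset.range n, β N k ω * ε k ω) atTop (nhds c) :=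
    ae_all_iff.2 fun N => ae_exists_tendsto_sum_mul_of_sum_sq_le
      (fun n => (hα n).indicator (hA N n)) hε (hβB N) hεC hmds (hβR N)
  filter_upwards [hconv, hsum] with ω hω hs
  obtain ⟨N, hN⟩ := exists_nat_ge (∑' n, α n ω ^ 2)
  have hmem : ∀ n, ω ∈ A N n := fun n =>
    (hs.sum_le_tsum _ fun k _ => sq_nonneg _).trans hN
  simpa [β, hmem] using hω N

/-- The past σ-algebras of a process, as a filtration. -/
noncomputable def pastFiltrationBundled {Ω : Type*} {m0 : MeasurableSpace Ω}
    (ε : ℕ → Ω → ℝ) (hε : ∀ i, StronglyMeasurable (ε i)) : Filtration ℕ m0 where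
  seq := pastFiltration ε hε
  mono' := monotone_nat_of_le_succ fun n => by
    cases n with
    | zero => exact bot_le
    | succ n => exact (Filtration.natural ε hε).mono n.le_succ
  le' n := by
    cases n with
    | zero => exact bot_le
    | succ n => exact (Filtration.natural ε hε).le n

/-- almost sure convergence of the stochastic approximation iterates.
If `f̃` is bounded Lipschitz, negative below `R_ℓ` and positive above `R_u`, `ε` is a
bounded martingale difference sequence, and the nonnegative predictable step sizes
satisfy the Robbins–Monro conditions a.s., then the iterates
`ν_{m+1} = ν_m − α_m (f̃(ν_m) + ε_m)` started in `[R_ℓ, R_u]` converge almost surely to a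
random variable `ν̃ ∈ [R_ℓ, R_u]` with `f̃(ν̃) = 0`. -/
theorem as_convergence_stochastic_approximation
    {Ω : Type*} {m0 : MeasurableSpace Ω} (μ : Measure Ω) [IsProbabilityMeasure μ]
    (Rl Ru : ℝ) (hRlu : Rl < Ru)
    (ftilde : ℝ → ℝ)
    (hbdd : ∃ C : ℝ, ∀ ν, |ftilde ν| ≤ C)
    (hlip : ∃ K : NNReal, LipschitzWith K ftilde)
    (hneg : ∀ ν : ℝ, ν < Rl → ftilde ν < 0)
    (hpos : ∀ ν : ℝ, Ru < ν → 0 < ftilde ν)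
    (ε : ℕ → Ω → ℝ) (hεmeas : ∀ i, StronglyMeasurable (ε i))
    (hεbdd : ∃ C : ℝ, ∀ m ω, |ε m ω| ≤ C)
    (hMDS : ∀ m, μ[ε m | pastFiltration ε hεmeas m] =ᵐ[μ] 0)
    (α : ℕ → Ω → ℝ)
    (hα0 : ∀ m ω, 0 ≤ α m ω)
    (hαpred : ∀ m, StronglyMeasurable[pastFiltration ε hεmeas m] (α m))
    (hRM : ∀ᵐ ω ∂μ, ¬ Summable (fun m => α m ω) ∧ Summable (fun m => (α m ω) ^ 2))
    (ν₀ : ℝ) (hν₀ : ν₀ ∈ Set.Icc Rl Ru)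
    (x : ℕ → Ω → ℝ) (hx0 : ∀ ω, x 0 ω = ν₀)
    (hxrec : ∀ m ω, x (m + 1) ω = x m ω - α m ω * (ftilde (x m ω) + ε m ω)) :
    ∃ νtilde : Ω → ℝ, ∀ᵐ ω ∂μ,
      Tendsto (fun m => x m ω) atTop (nhds (νtilde ω)) ∧
      νtilde ω ∈ Set.Icc Rl Ru ∧ ftilde (νtilde ω) = 0 := by
  obtain ⟨C, hC⟩ := hbdd
  obtain ⟨K, hK⟩ := hlip
  obtain ⟨D, hD⟩ := hεbdd
  refine Eventually.choice (l := ae μ) (r := fun ω q =>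
    Tendsto (fun m => x m ω) atTop (nhds q) ∧ q ∈ Set.Icc Rl Ru ∧ ftilde q = 0) ?_
  have hnoise := ae_exists_tendsto_sum_mul_of_summable_sq
    (ℱ := pastFiltrationBundled ε hεmeas) hαpred
    (fun n => Filtration.stronglyAdapted_natural hεmeas n) hD hMDS (hRM.mono fun _ h => h.2)
  filter_upwards [hnoise, hRM] with ω ⟨s, hs⟩ ⟨hdiv, hsq⟩
  exact exists_tendsto_isRoot_of_noise_tendsto hK.continuous hC hneg hpos (fun n => hα0 n ω) hdiv
    hsq hs fun n => hxrec n ω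
end
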